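/- Let M ∈ M_d(ℂ) be nonlinearly nonresonant, i.e. its eigenvalues λ_1, …, λ_d satisfy k + m·λ − λ_i ≠ 0 for all k ∈ ℕ, all m ∈ ℕ^d with |m| ≥ 2, and all i ∈ {1, …, d}. Then for every integer n ≥ 2 and every k ∈ ℕ (including k = 0), the operator k·Id + J_M is invertible on 𝒫_n. -/

import Mathlib

open Matrix Set

/-- `HomogPolyMap d n q` : `q : ℂᵈ → ℂᵈ` belongs to `𝒫_n`, i.e. it is a vector-valued
polynomial map homogeneous of degree `n`: `q(w) = Σ_{|m| = n} q_m w^m`. -/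
def HomogPolyMap (d n : ℕ) (q : (Fin d → ℂ) → Fin d → ℂ) : Prop :=
  ∃ c : (Fin d → ℕ) → Fin d → ℂ,
    q = fun w =>
      ∑ m ∈ (Finset.Iic (fun _ => n : Fin d → ℕ)).filter (fun m => ∑ i, m i = n),
        (∏ i, w i ^ m i) • c m

open MvPolynomial in
/-- The derivation `p ↦ (d p)(M w)` on polynomials. -/
noncomputable def LD {d : ℕ} (M : Matrix (Fin d) (Fin d) ℂ) :
    Derivation ℂ (MvPolynomial (Fin d) ℂ) (MvPolynomial (Fin d) ℂ) :=
  ∑ i, (∑ j, C (M i j) * X j : MvPolynomial (Fin d) ℂ) • pderiv i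

section aux
open MvPolynomial

lemma LD_apply {d : ℕ} (M : Matrix (Fin d) (Fin d) ℂ) (p : MvPolynomial (Fin d) ℂ) :
    LD M p = ∑ i, (∑ j, C (M i j) * X j) * pderiv i p := by
  have h : ∀ s : Finset (Fin d),
      (∑ i ∈ s, (∑ j, C (M i j) * X j : MvPolynomial (Fin d) ℂ) • pderiv (R := ℂ) i) p
        = ∑ i ∈ s, (∑ j, C (M i j) * X j) * pderiv i p := by
    intro s
    induction s using Finset.induction_on with
    | empty => simp
    | insert a s ha ih =>
      rw [Finset.sum_insert ha, Finset.sum_insert ha, Derivation.add_apply, ih]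
      rfl
  exact h _

lemma LD_C_mul {d : ℕ} (M : Matrix (Fin d) (Fin d) ℂ) (a : ℂ) (p : MvPolynomial (Fin d) ℂ) :
    LD M (C a * p) = C a * LD M p := by
  rw [← smul_eq_C_mul, Derivation.map_smul, smul_eq_C_mul]

lemma pderiv_comm_aux {d : ℕ} (i j : Fin d) (p : MvPolynomial (Fin d) ℂ) :
    pderiv i (pderiv j p) = pderiv j (pderiv i p) := by
  have h : ⁅(pderiv i : Derivation ℂ (MvPolynomial (Fin d) ℂ) (MvPolynomial (Fin d) ℂ)),
      (pderiv j : Derivation ℂ (MvPolynomial (Fin d) ℂ) (MvPolynomial (Fin d) ℂ))⁆ = 0 := by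
    apply derivation_ext
    intro l
    rw [Derivation.commutator_apply]
    simp [pderiv_X, Pi.single_apply]
    split_ifs <;> simp
  have h2 := congrArg (fun D : Derivation ℂ (MvPolynomial (Fin d) ℂ) (MvPolynomial (Fin d) ℂ) =>
    D p) h
  simp only [Derivation.commutator_apply] at h2
  exact sub_eq_zero.mp h2

lemma pderiv_LD {d : ℕ} (M : Matrix (Fin d) (Fin d) ℂ) (l : Fin d)
    (p : MvPolynomial (Fin d) ℂ) :
    pderiv l (LD M p) = LD M (pderiv l p) + ∑ i, C (M i l) * pderiv i p := by
  rw [LD_apply, LD_apply, map_sum, ← Finset.sum_add_distrib]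
  refine Finset.sum_congr rfl fun i _ => ?_
  rw [pderiv_mul, pderiv_comm_aux l i, add_comm]
  congr 2
  rw [map_sum]
  simp [pderiv_C_mul, pderiv_X, Pi.single_apply]

lemma LD_homog {d n : ℕ} (M : Matrix (Fin d) (Fin d) ℂ) {p : MvPolynomial (Fin d) ℂ}
    (hp : p.IsHomogeneous n) : (LD M p).IsHomogeneous n := by
  rw [LD_apply]
  apply IsHomogeneous.sum
  intro i _
  rcases n with _ | n
  · rw [← totalDegree_zero_iff_isHomogeneous, totalDegree_eq_zero_iff_eq_C] at hp
    rw [hp, pderiv_C, mul_zero]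
    apply isHomogeneous_zero
  · have h1 : (∑ j, C (M i j) * X j : MvPolynomial (Fin d) ℂ).IsHomogeneous 1 :=
      IsHomogeneous.sum _ _ _ fun j _ => isHomogeneous_C_mul_X _ _
    have := h1.mul (hp.pderiv (i := i))
    simpa [add_comm] using this

lemma mulVec_homog {d n : ℕ} (N : Matrix (Fin d) (Fin d) ℂ)
    {r : Fin d → MvPolynomial (Fin d) ℂ} (hr : ∀ i, (r i).IsHomogeneous n) (i : Fin d) :
    ((N.map C *ᵥ r) i).IsHomogeneous n := by
  simp only [Matrix.mulVec, dotProduct, Matrix.map_apply]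
  exact IsHomogeneous.sum _ _ _ fun j _ => (hr j).C_mul _

lemma LD_mulVec {d : ℕ} (M N : Matrix (Fin d) (Fin d) ℂ)
    (r : Fin d → MvPolynomial (Fin d) ℂ) (i : Fin d) :
    LD M ((N.map C *ᵥ r) i) = (N.map C *ᵥ (fun j => LD M (r j))) i := by
  simp only [Matrix.mulVec, dotProduct, Matrix.map_apply, map_sum, LD_C_mul]

lemma kernel_aux {d n : ℕ} (M N : Matrix (Fin d) (Fin d) ℂ) (lam : Fin d → ℂ) (a b : ℂ)
    (s : Finset (Fin d)) : ∀ (r : Fin d → MvPolynomial (Fin d) ℂ), r ≠ 0 →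
    (∀ i, (r i).IsHomogeneous n) →
    (∀ i, LD M (r i) = C a * r i + C b * (N.map C *ᵥ r) i) →
    (Polynomial.aeval (N.map C : Matrix (Fin d) (Fin d) (MvPolynomial (Fin d) ℂ))
      (∏ i ∈ s, (Polynomial.X - Polynomial.C (lam i)))) *ᵥ r = 0 →
    ∃ i, ∃ p : MvPolynomial (Fin d) ℂ, p ≠ 0 ∧ p.IsHomogeneous n ∧
      LD M p = C (a + b * lam i) * p := by
  induction s using Finset.induction_on with
  | empty => intro r hr _ _ h; simp at h; exact absurd h hr
  | insert l s hl ih =>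
    intro r hr hh hL h
    set r' : Fin d → MvPolynomial (Fin d) ℂ := fun i => (N.map C *ᵥ r) i - C (lam l) * r i with hr'
    by_cases h0 : r' = 0
    · obtain ⟨i, hi⟩ := Function.ne_iff.mp hr
      refine ⟨l, r i, hi, hh i, ?_⟩
      have := congrFun h0 i
      simp only [hr', Pi.zero_apply, sub_eq_zero] at this
      rw [hL, this]
      simp only [map_add, map_mul]
      ring
    · refine ih r' h0 ?_ ?_ ?_
      · intro i
        exact (mulVec_homog N hh i).sub ((hh i).C_mul _)
      · intro i
        have e1 : (fun j => LD M (r j)) =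
            (C a : MvPolynomial (Fin d) ℂ) • r + (C b : MvPolynomial (Fin d) ℂ) • (N.map C *ᵥ r) := by
          funext j; simp [hL]
        have e2 : r' = N.map C *ᵥ r - (C (lam l) : MvPolynomial (Fin d) ℂ) • r := by
          funext j; simp [hr']
        have e3 : LD M (r' i) = (N.map C *ᵥ (fun j => LD M (r j))) i - C (lam l) * LD M (r i) := by
          rw [hr']; simp only [map_sub, LD_mulVec, LD_C_mul]
        rw [e3, e1, hL, e2]
        simp only [Matrix.mulVec_add, Matrix.mulVec_sub, Matrix.mulVec_smul, Pi.add_apply,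
          Pi.sub_apply, Pi.smul_apply, smul_eq_mul]
        ring
      · rw [Finset.prod_insert hl, mul_comm, map_mul, ← Matrix.mulVec_mulVec] at h
        have e : (Polynomial.aeval (N.map C : Matrix (Fin d) (Fin d) (MvPolynomial (Fin d) ℂ))
            (Polynomial.X - Polynomial.C (lam l))) *ᵥ r = r' := by
          rw [map_sub, Polynomial.aeval_X, Polynomial.aeval_C, Matrix.sub_mulVec]
          funext i
          simp [hr', Matrix.algebraMap_eq_diagonal, Matrix.mulVec_diagonal,
            MvPolynomial.algebraMap_eq]
        rw [← e]
        exact h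

lemma kernel_main {d n : ℕ} (M N : Matrix (Fin d) (Fin d) ℂ) (lam : Fin d → ℂ) (a b : ℂ)
    (hlam : N.charpoly = ∏ i, (Polynomial.X - Polynomial.C (lam i)))
    (r : Fin d → MvPolynomial (Fin d) ℂ) (hr : r ≠ 0)
    (hh : ∀ i, (r i).IsHomogeneous n)
    (hL : ∀ i, LD M (r i) = C a * r i + C b * (N.map C *ᵥ r) i) :
    ∃ i, ∃ p : MvPolynomial (Fin d) ℂ, p ≠ 0 ∧ p.IsHomogeneous n ∧
      LD M p = C (a + b * lam i) * p := by
  refine kernel_aux M N lam a b Finset.univ r hr hh hL ?_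
  rw [← hlam]
  have h : (N.map C : Matrix (Fin d) (Fin d) (MvPolynomial (Fin d) ℂ))
      = (Algebra.ofId ℂ (MvPolynomial (Fin d) ℂ)).mapMatrix N := by
    ext1 i j; rfl
  rw [h, Polynomial.aeval_algHom_apply, Matrix.aeval_self_charpoly, map_zero, Matrix.zero_mulVec]

lemma eigen_LD {d : ℕ} (M : Matrix (Fin d) (Fin d) ℂ) (lam : Fin d → ℂ)
    (hlam : M.charpoly = ∏ i, (Polynomial.X - Polynomial.C (lam i))) (n : ℕ) :
    ∀ (p : MvPolynomial (Fin d) ℂ) (ν : ℂ), p ≠ 0 → p.IsHomogeneous n → LD M p = C ν * p →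
    ∃ m : Fin d → ℕ, ∑ j, m j = n ∧ ∑ j, (m j : ℂ) * lam j = ν := by
  induction n with
  | zero =>
    intro p ν hp hh hL
    refine ⟨0, by simp, ?_⟩
    rw [← totalDegree_zero_iff_isHomogeneous, totalDegree_eq_zero_iff_eq_C] at hh
    have h0 : LD M p = 0 := by rw [hh]; exact derivation_C _ _
    rw [h0] at hL
    have := (mul_eq_zero.mp hL.symm).resolve_right hp
    simp at this
    simp [this]
  | succ n ih =>
    intro p ν hp hh hL
    obtain ⟨i, p', hp', hh', hL'⟩ := kernel_main (n := n) M Mᵀ lam ν (-1)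
      (by rw [Matrix.charpoly_transpose, hlam]) (fun l => pderiv l p)
      (by
        intro h0
        have := hh.sum_X_mul_pderiv
        have h1 : ∀ i, pderiv i p = 0 := fun i => congrFun h0 i
        simp only [h1, mul_zero, Finset.sum_const_zero] at this
        exact (smul_ne_zero (Nat.succ_ne_zero n) hp) this.symm)
      (fun l => hh.pderiv)
      (by
        intro l
        have := pderiv_LD M l p
        rw [hL, pderiv_C_mul] at this
        rw [this]
        simp [Matrix.mulVec, dotProduct])
    obtain ⟨m, hm, hm2⟩ := ih p' _ hp' hh' hL'
    refine ⟨m + Pi.single i 1, ?_, ?_⟩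
    · simp [Finset.sum_add_distrib, hm]
    · simp only [Pi.add_apply, Nat.cast_add, add_mul, Finset.sum_add_distrib, hm2]
      simp [Pi.single_apply]

lemma hasFDerivAt_eval {d : ℕ} (p : MvPolynomial (Fin d) ℂ) (w : Fin d → ℂ) :
    HasFDerivAt (fun w => eval w p)
      (∑ i, eval w (pderiv i p) • ContinuousLinearMap.proj (R := ℂ) (φ := fun _ : Fin d => ℂ) i)
      w := by
  induction p using MvPolynomial.induction_on with
  | C a => 
    refine ((hasFDerivAt_const (𝕜 := ℂ) a w).congr_fderiv ?_).congr_of_eventuallyEq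
      (.of_forall fun w => by simp)
    ext v
    simp
  | add p q hp hq =>
    refine ((hp.add hq).congr_fderiv ?_).congr_of_eventuallyEq (.of_forall fun w => by simp)
    ext v
    simp [add_mul, Finset.sum_add_distrib]
  | mul_X p j hp =>
    have hx : HasFDerivAt (fun w : Fin d → ℂ => w j)
      (ContinuousLinearMap.proj (R := ℂ) (φ := fun _ : Fin d => ℂ) j) w := hasFDerivAt_apply j w
    refine ((hp.mul hx).congr_fderiv ?_).congr_of_eventuallyEq (.of_forall fun w => by simp)
    ext v
    simp [pderiv_mul, pderiv_X, Pi.single_apply, add_mul, Finset.sum_add_distrib,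
      Finset.mul_sum, apply_ite, mul_assoc]

lemma fderiv_eval {d : ℕ} (M : Matrix (Fin d) (Fin d) ℂ)
    (Q : Fin d → MvPolynomial (Fin d) ℂ) (w : Fin d → ℂ) :
    fderiv ℂ (fun w i => eval w (Q i)) w (M *ᵥ w) = fun i => eval w (LD M (Q i)) := by
  have h := hasFDerivAt_pi.mpr fun i => hasFDerivAt_eval (Q i) w
  rw [h.fderiv]
  funext i
  simp [LD_apply, Matrix.mulVec, dotProduct, mul_comm]

lemma homog_iff {d n : ℕ} (q : (Fin d → ℂ) → Fin d → ℂ) :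
    HomogPolyMap d n q ↔ ∃ Q : Fin d → MvPolynomial (Fin d) ℂ,
      (∀ i, (Q i).IsHomogeneous n) ∧ q = fun w i => eval w (Q i) := by
  constructor
  · rintro ⟨c, rfl⟩
    refine ⟨fun i => ∑ m ∈ (Finset.Iic (fun _ => n : Fin d → ℕ)).filter (fun m => ∑ i, m i = n),
      monomial (Finsupp.equivFunOnFinite.symm m) (c m i), ?_, ?_⟩
    · intro i
      refine IsHomogeneous.sum _ _ _ fun m hm => isHomogeneous_monomial _ ?_
      rw [Finsupp.degree_eq_sum]
      simpa using (Finset.mem_filter.mp hm).2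
    · funext w i
      simp [eval_monomial, Finsupp.prod_fintype, mul_comm, Finset.sum_apply]
  · rintro ⟨Q, hQ, rfl⟩
    refine ⟨fun m i => coeff (Finsupp.equivFunOnFinite.symm m) (Q i), ?_⟩
    funext w i
    rw [eval_eq']
    simp only [Finset.sum_apply, Pi.smul_apply, smul_eq_mul]
    symm
    refine (Finset.sum_of_injOn (fun m : Fin d →₀ ℕ => (m : Fin d → ℕ)) ?_ ?_ ?_ ?_).symm
    · exact fun a _ b _ h => DFunLike.coe_injective h
    · intro m hm
      have h1 := (hQ i).degree_eq_sum_deg_support hm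
      have h2 : ∑ j, m j = n := by rw [← Finsupp.degree_eq_sum]; exact h1.symm
      simp only [Finset.coe_filter, Finset.mem_Iic, Set.mem_ofPred_eq]
      refine ⟨fun j => ?_, h2⟩
      rw [← h2]
      exact Finset.single_le_sum (f := fun j => m j) (fun _ _ => Nat.zero_le _) (Finset.mem_univ j)
    · intro m _ hm
      have : coeff (Finsupp.equivFunOnFinite.symm m) (Q i) = 0 := by
        by_contra h
        exact hm ⟨Finsupp.equivFunOnFinite.symm m, by simpa using h, by simp⟩
      rw [this, mul_zero]
    · intro m _
      rw [mul_comm]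
      congr 2
      ext; simp

/-- The operator `k + J_M` on polynomial vectors. -/
noncomputable def TOp {d : ℕ} (M : Matrix (Fin d) (Fin d) ℂ) (k : ℕ) :
    (Fin d → MvPolynomial (Fin d) ℂ) →ₗ[ℂ] (Fin d → MvPolynomial (Fin d) ℂ) where
  toFun Q i := C (k : ℂ) * Q i + (LD M (Q i) - (M.map C *ᵥ Q) i)
  map_add' P Q := by
    funext i
    simp only [Pi.add_apply, map_add, Matrix.mulVec_add]
    ring
  map_smul' a P := by
    funext i
    simp only [Pi.smul_apply, Matrix.mulVec_smul, RingHom.id_apply,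
      smul_eq_C_mul, LD_C_mul]
    ring

lemma TOp_apply {d : ℕ} (M : Matrix (Fin d) (Fin d) ℂ) (k : ℕ)
    (Q : Fin d → MvPolynomial (Fin d) ℂ) (i : Fin d) :
    TOp M k Q i = C (k : ℂ) * Q i + (LD M (Q i) - (M.map C *ᵥ Q) i) := rfl

lemma TOp_eval {d : ℕ} (M : Matrix (Fin d) (Fin d) ℂ) (k : ℕ)
    (Q : Fin d → MvPolynomial (Fin d) ℂ) (w : Fin d → ℂ) :
    (k : ℂ) • (fun i => eval w (Q i)) + ((fderiv ℂ (fun w i => eval w (Q i)) w) (M *ᵥ w)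
      - M *ᵥ (fun i => eval w (Q i))) = fun i => eval w (TOp M k Q i) := by
  rw [fderiv_eval]
  funext i
  simp [TOp_apply, Matrix.mulVec, dotProduct]

end aux

/-- If `M` is nonlinearly nonresonant (`k + m·λ − λᵢ ≠ 0` for all `k ∈ ℕ`, `|m| ≥ 2`,
`1 ≤ i ≤ d`), then for every `n ≥ 2` and every `k ∈ ℕ` the operator `k·Id + J_M`,
where `J_M q = (d_w q)(M w) − M q`, is invertible (bijective) on `𝒫_n`. -/
theorem stmt_18 (d n : ℕ) (hd : 1 ≤ d) (hn : 2 ≤ n)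
    (M : Matrix (Fin d) (Fin d) ℂ) (lam : Fin d → ℂ)
    (hlam : M.charpoly = ∏ i, (Polynomial.X - Polynomial.C (lam i)))
    (hres : ∀ (k : ℕ) (m : Fin d → ℕ) (i : Fin d), 2 ≤ ∑ j, m j →
      (k : ℂ) + (∑ j, (m j : ℂ) * lam j) - lam i ≠ 0)
    (k : ℕ) :
    ∀ g : (Fin d → ℂ) → Fin d → ℂ, HomogPolyMap d n g →
      ∃! q : (Fin d → ℂ) → Fin d → ℂ, HomogPolyMap d n q ∧
        ∀ w, (k : ℂ) • q w + ((fderiv ℂ q w) (M *ᵥ w) - M *ᵥ q w) = g w := by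
  -- injectivity
  have hinj : ∀ Q : Fin d → MvPolynomial (Fin d) ℂ, (∀ i, (Q i).IsHomogeneous n) →
      TOp M k Q = 0 → Q = 0 := by
    intro Q hQ h
    by_contra h0
    obtain ⟨i, p, hp, hh, hL⟩ := kernel_main M M lam (-(k : ℂ)) 1 hlam Q h0 hQ (by
      intro i
      have := congrFun h i
      rw [TOp_apply, Pi.zero_apply] at this
      rw [map_neg, map_one]
      linear_combination this)
    obtain ⟨m, hm, hm2⟩ := eigen_LD M lam hlam n p _ hp hh hL
    refine hres k m i (by omega) ?_
    rw [hm2]; ring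
  let S : Submodule ℂ (Fin d → MvPolynomial (Fin d) ℂ) :=
    Submodule.pi Set.univ fun _ => MvPolynomial.homogeneousSubmodule (Fin d) ℂ n
  have hS : ∀ Q, Q ∈ S ↔ ∀ i, (Q i).IsHomogeneous n := by
    intro Q; simp [S, Submodule.mem_pi]
  have hmap : ∀ Q ∈ S, TOp M k Q ∈ S := by
    intro Q hQ
    rw [hS] at hQ ⊢
    intro i
    rw [TOp_apply]
    exact ((hQ i).C_mul _).add ((LD_homog M (hQ i)).sub (mulVec_homog M hQ i))
  have hfin : FiniteDimensional ℂ S := by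
    have hf : Module.Finite ℂ (MvPolynomial.homogeneousSubmodule (Fin d) ℂ n) :=
      Module.Finite.iff_fg.2 (MvPolynomial.homogeneousSubmodule_fg _ _ n)
    let f : S →ₗ[ℂ] (Fin d → MvPolynomial.homogeneousSubmodule (Fin d) ℂ n) :=
      { toFun := fun Q i => ⟨Q.1 i, (hS Q.1).1 Q.2 i⟩
        map_add' := fun _ _ => rfl
        map_smul' := fun _ _ => rfl }
    refine FiniteDimensional.of_injective f fun P Q h => ?_
    apply Subtype.ext
    funext i
    exact congrArg Subtype.val (congrFun h i)
  have hsurj : Function.Surjective ((TOp M k).restrict hmap) := by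
    apply LinearMap.surjective_of_injective
    rw [← LinearMap.ker_eq_bot, LinearMap.ker_eq_bot']
    intro Q hQ
    apply Subtype.ext
    exact hinj Q.1 ((hS _).1 Q.2) (congrArg Subtype.val hQ)
  intro g hg
  obtain ⟨G, hG, rfl⟩ := (homog_iff g).1 hg
  obtain ⟨⟨Q, hQ⟩, hQG⟩ := hsurj ⟨G, (hS G).2 hG⟩
  have hQG : TOp M k Q = G := congrArg Subtype.val hQG
  rw [hS] at hQ
  refine ⟨fun w i => MvPolynomial.eval w (Q i), ⟨(homog_iff _).2 ⟨Q, hQ, rfl⟩, ?_⟩, ?_⟩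
  · intro w
    rw [TOp_eval, hQG]
  · rintro q ⟨hq, hqe⟩
    obtain ⟨P, hP, rfl⟩ := (homog_iff q).1 hq
    have hPG : TOp M k P = G := by
      funext i
      apply MvPolynomial.funext
      intro w
      have := hqe w
      rw [TOp_eval] at this
      exact congrFun this i
    have : P - Q = 0 := hinj _ (fun i => (hP i).sub (hQ i)) (by rw [map_sub, hPG, hQG, sub_self])
    rw [sub_eq_zero.mp this]
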